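/- Fix real numbers S > 0 and q > 0. Then the function N ↦ p̂(S, N, 1, q) = Q( √S / √( (q/(2S) + 1)/N + q/(4S·N²) + 1 ) ) is strictly decreasing on (0, ∞). -/

import Mathlib

open MeasureTheory

/-- The Gaussian tail function `Q(x) = (1/√(2π)) · ∫_x^∞ exp(−t²/2) dt`. -/
noncomputable def gaussQ (x : ℝ) : ℝ :=
  (Real.sqrt (2 * Real.pi))⁻¹ * ∫ t in Set.Ioi x, Real.exp (-t ^ 2 / 2)

/-- The approximate probability of error `p̂(S, N, γ, q)` from the paper. -/
noncomputable def phat (S N γ q : ℝ) : ℝ :=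
  (1 / 2) * gaussQ ((Real.sqrt S + (1 / (4 * N)) * ((1 - γ) / γ) * (q / Real.sqrt S)) /
      Real.sqrt ((1 / (4 * N)) * ((1 + γ) / γ) * (q / S)
        + (1 / (8 * N ^ 2)) * ((1 + γ ^ 2) / γ ^ 2) * (q / S) + 1 / (γ * N) + 1))
  + (1 / 2) * gaussQ ((Real.sqrt S - (1 / (4 * N)) * ((1 - γ) / γ) * (q / Real.sqrt S)) /
      Real.sqrt ((1 / (4 * N)) * ((1 + γ) / γ) * (q / S)
        + (1 / (8 * N ^ 2)) * ((1 + γ ^ 2) / γ ^ 2) * (q / S) + 1 / N + 1))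

theorem integrable_exp_neg_sq_div_two :
    Integrable (fun t : ℝ => Real.exp (-t ^ 2 / 2)) := by
  convert integrable_exp_neg_mul_sq (b := 1 / 2) (by norm_num) using 3
  ring

theorem gaussQ_strictAnti : StrictAnti gaussQ := by
  intro a b hab
  have hI := integrable_exp_neg_sq_div_two
  have hpos : 0 < ∫ t in a..b, Real.exp (-t ^ 2 / 2) :=
    intervalIntegral.intervalIntegral_pos_of_pos hI.intervalIntegrable
      (fun t => Real.exp_pos _) hab
  rw [← intervalIntegral.integral_Ioi_sub_Ioi hI.integrableOn hab.le, sub_pos] at hpos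
  exact mul_lt_mul_of_pos_left hpos (by positivity)

theorem phat_one (S N q : ℝ) :
    phat S N 1 q = gaussQ (√S /
      √((1 / (2 * N)) * (q / S) + (1 / (4 * N ^ 2)) * (q / S) + 1 / N + 1)) := by
  unfold phat
  have h : (1 / (4 * N)) * ((1 + 1) / 1) * (q / S)
      + (1 / (8 * N ^ 2)) * ((1 + 1 ^ 2) / 1 ^ 2) * (q / S) + 1 / N + 1
      = (1 / (2 * N)) * (q / S) + (1 / (4 * N ^ 2)) * (q / S) + 1 / N + 1 := by
    ring
  simp only [sub_self, zero_div, mul_zero, zero_mul, add_zero, sub_zero, one_mul, h]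
  ring

theorem phat_strictAnti_in_N (S q : ℝ) (hS : 0 < S) (hq : 0 < q) :
    StrictAntiOn (fun N : ℝ => phat S N 1 q) (Set.Ioi 0) := by
  intro M hM N hN hMN
  rw [Set.mem_Ioi] at hM hN
  simp only [phat_one]
  apply gaussQ_strictAnti
  apply div_lt_div_of_pos_left (Real.sqrt_pos.2 hS) (Real.sqrt_pos.2 (by positivity))
  apply Real.sqrt_lt_sqrt (by positivity)
  gcongr
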